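/- For every real α with 0 < α < 1 and every complex number s not lying in the closed negative real half-line (-∞, 0], the identity 1/s^α = ∫_0^{+∞} μ_α(ω)/(s+ω) dω holds, where s^α denotes the principal branch of the complex power and the integrand is the complex-valued function ω ↦ (sin(απ)/(π ω^α)) · 1/(s+ω) on (0, +∞). -/

import Mathlib

open MeasureTheory Set Filter Topology

/-- The Gamma integral as a lower Lebesgue integral. -/
lemma lintegral_rpow_mul_exp_neg_mul_Ioi {a r : ℝ} (ha : 0 < a) (hr : 0 < r) :
    ∫⁻ t in Ioi (0 : ℝ), ENNReal.ofReal (t ^ (a - 1) * Real.exp (-(r * t))) =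
      ENNReal.ofReal ((1 / r) ^ a * Real.Gamma a) := by
  have h := Real.integral_rpow_mul_exp_neg_mul_Ioi ha hr
  have hpos : 0 < (1 / r) ^ a * Real.Gamma a :=
    mul_pos (Real.rpow_pos_of_pos (by positivity) _) (Real.Gamma_pos_of_pos ha)
  have hint : IntegrableOn (fun t : ℝ => t ^ (a - 1) * Real.exp (-(r * t))) (Ioi 0) := by
    by_contra hcon
    rw [integral_undef hcon] at h
    exact hpos.ne h
  rw [← h, ofReal_integral_eq_lintegral_ofReal hint]
  filter_upwards [ae_restrict_mem measurableSet_Ioi] with t ht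
  exact mul_nonneg (Real.rpow_nonneg (le_of_lt ht) _) (Real.exp_pos _).le

/-- The Stieltjes transform of `ω ^ (-α)` on the positive half-line. -/
lemma lintegral_rpow_neg_div_add_Ioi {α x : ℝ} (hα0 : 0 < α) (hα1 : α < 1) (hx : 0 < x) :
    ∫⁻ ω in Ioi (0 : ℝ), ENNReal.ofReal (ω ^ (-α) / (x + ω)) =
      ENNReal.ofReal (Real.pi / Real.sin (Real.pi * α) * x ^ (-α)) := by
  calc
    _ = ∫⁻ ω in Ioi (0 : ℝ), ∫⁻ t in Ioi (0 : ℝ),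
          ENNReal.ofReal (ω ^ (-α) * Real.exp (-((x + ω) * t))) := by
      refine setLIntegral_congr_fun measurableSet_Ioi fun ω hω => ?_
      have hω : 0 < ω := hω
      have h := lintegral_rpow_mul_exp_neg_mul_Ioi one_pos (add_pos hx hω)
      simp only [sub_self, Real.rpow_zero, one_mul, Real.rpow_one, Real.Gamma_one, mul_one] at h
      have hnn : 0 ≤ ω ^ (-α) := Real.rpow_nonneg hω.le _
      simp_rw [ENNReal.ofReal_mul hnn]
      rw [lintegral_const_mul' _ _ ENNReal.ofReal_ne_top, h, ← ENNReal.ofReal_mul hnn,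
        mul_one_div]
    _ = ∫⁻ t in Ioi (0 : ℝ), ∫⁻ ω in Ioi (0 : ℝ),
          ENNReal.ofReal (ω ^ (-α) * Real.exp (-((x + ω) * t))) := by
      refine lintegral_lintegral_swap (Measurable.aemeasurable ?_)
      simp only [Function.uncurry_def]
      fun_prop
    _ = ∫⁻ t in Ioi (0 : ℝ), ENNReal.ofReal (Real.Gamma (1 - α)) *
          ENNReal.ofReal (t ^ (α - 1) * Real.exp (-(x * t))) := by
      refine setLIntegral_congr_fun measurableSet_Ioi fun t ht => ?_
      have ht : 0 < t := ht
      have h := lintegral_rpow_mul_exp_neg_mul_Ioi (sub_pos.2 hα1) ht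
      have hsplit : ∀ ω : ℝ, ω ^ (-α) * Real.exp (-((x + ω) * t)) =
          Real.exp (-(x * t)) * (ω ^ (1 - α - 1) * Real.exp (-(t * ω))) := fun ω => by
        rw [show 1 - α - 1 = -α by ring, mul_left_comm, ← Real.exp_add]
        ring_nf
      simp_rw [hsplit, ENNReal.ofReal_mul (Real.exp_pos (-(x * t))).le]
      rw [lintegral_const_mul' _ _ ENNReal.ofReal_ne_top, h,
        ← ENNReal.ofReal_mul (Real.exp_pos _).le,
        ← ENNReal.ofReal_mul (Real.Gamma_pos_of_pos (sub_pos.2 hα1)).le, one_div,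
        Real.inv_rpow ht.le, ← Real.rpow_neg ht.le, neg_sub]
      ring_nf
    _ = _ := by
      have hrefl := Real.Gamma_mul_Gamma_one_sub α
      rw [lintegral_const_mul' _ _ ENNReal.ofReal_ne_top,
        lintegral_rpow_mul_exp_neg_mul_Ioi hα0 hx,
        ← ENNReal.ofReal_mul (Real.Gamma_pos_of_pos (sub_pos.2 hα1)).le, one_div,
        Real.inv_rpow hx.le, ← Real.rpow_neg hx.le, ← hrefl]
      ring_nf

lemma sin_pi_mul_pos {α : ℝ} (hα0 : 0 < α) (hα1 : α < 1) : 0 < Real.sin (Real.pi * α) :=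
  Real.sin_pos_of_pos_of_lt_pi (mul_pos Real.pi_pos hα0)
    (by nlinarith [Real.pi_pos])

lemma integral_rpow_neg_div_add_Ioi {α x : ℝ} (hα0 : 0 < α) (hα1 : α < 1) (hx : 0 < x) :
    ∫ ω in Ioi (0 : ℝ), ω ^ (-α) / (x + ω) =
      Real.pi / Real.sin (Real.pi * α) * x ^ (-α) := by
  have hsin := sin_pi_mul_pos hα0 hα1
  rw [integral_eq_lintegral_of_nonneg_ae, lintegral_rpow_neg_div_add_Ioi hα0 hα1 hx,
    ENNReal.toReal_ofReal]
  · have := Real.pi_pos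
    positivity
  · filter_upwards [ae_restrict_mem measurableSet_Ioi] with ω hω
    have hω : 0 < ω := hω
    simp only [Pi.zero_apply]
    positivity
  · exact (by fun_prop : Measurable fun ω : ℝ => ω ^ (-α) / (x + ω)).aestronglyMeasurable

lemma integrableOn_rpow_neg_div_add_Ioi {α x : ℝ} (hα0 : 0 < α) (hα1 : α < 1) (hx : 0 < x) :
    IntegrableOn (fun ω : ℝ => ω ^ (-α) / (x + ω)) (Ioi 0) := by
  have hsin := sin_pi_mul_pos hα0 hα1
  have hpi := Real.pi_pos
  by_contra hcon
  have h := integral_rpow_neg_div_add_Ioi hα0 hα1 hx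
  rw [integral_undef hcon] at h
  exact (by positivity : 0 < Real.pi / Real.sin (Real.pi * α) * x ^ (-α)).ne h

/-- Near a point of the slit plane, `s + ω` is bounded below uniformly in `ω > 0`, both by a
constant and by a multiple of `1 + ω`. -/
lemma exists_bound_add_of_mem_slitPlane {s₀ : ℂ} (hs : s₀ ∈ Complex.slitPlane) :
    ∃ δ > 0, ∃ C > 0, ∀ s ∈ Metric.ball s₀ δ, ∀ ω : ℝ, 0 < ω →
      δ ≤ ‖s + ω‖ ∧ 1 + ω ≤ C * ‖s + ω‖ := by
  obtain ⟨ε, hε, hball⟩ := Metric.isOpen_iff.1 Complex.isOpen_slitPlane s₀ hs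
  have hδ : 0 < ε / 2 := half_pos hε
  refine ⟨ε / 2, hδ, (1 + ‖s₀‖ + ε / 2) / (ε / 2) + 1, by positivity, fun s hsb ω hω => ?_⟩
  rw [mem_ball_iff_norm] at hsb
  have hlow : ε / 2 ≤ ‖s + ω‖ := by
    by_contra! hlt
    have hmem : ((-ω : ℝ) : ℂ) ∈ Metric.ball s₀ ε := by
      rw [mem_ball_iff_norm]
      calc ‖((-ω : ℝ) : ℂ) - s₀‖ = ‖(s - s₀) - (s + ω)‖ := by
            congr 1
            push_cast
            ring
        _ ≤ ‖s - s₀‖ + ‖s + ω‖ := norm_sub_le _ _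
        _ < ε := by linarith
    have := hball hmem
    rw [Complex.ofReal_mem_slitPlane] at this
    linarith
  refine ⟨hlow, ?_⟩
  have hω' : ω ≤ ‖s + ω‖ + ‖s‖ := by
    calc ω = ‖(s + ω) - s‖ := by simp [abs_of_pos hω]
      _ ≤ _ := norm_sub_le _ _
  have hs' : ‖s‖ ≤ ‖s₀‖ + ‖s - s₀‖ := by
    simpa using norm_add_le s₀ (s - s₀)
  have hmul : 1 + ‖s₀‖ + ε / 2 ≤ (1 + ‖s₀‖ + ε / 2) / (ε / 2) * ‖s + ω‖ := by
    rw [div_mul_eq_mul_div, le_div_iff₀ hδ]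
    gcongr
  linarith

/-- The Stieltjes transform of `ω ^ (-α)` is holomorphic on the slit plane. -/
lemma differentiableOn_integral_rpow_neg_div_add {α : ℝ} (hα0 : 0 < α) (hα1 : α < 1) :
    DifferentiableOn ℂ (fun s : ℂ => ∫ ω in Ioi (0 : ℝ), ((ω ^ (-α) : ℝ) : ℂ) / (s + ω))
      Complex.slitPlane := by
  intro s₀ hs₀
  obtain ⟨δ, hδ, C, hC, hbound⟩ := exists_bound_add_of_mem_slitPlane hs₀
  have hint := integrableOn_rpow_neg_div_add_Ioi hα0 hα1 one_pos
  have hmeas : ∀ s : ℂ, Measurable fun ω : ℝ => ((ω ^ (-α) : ℝ) : ℂ) / (s + ω) := fun s => by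
    fun_prop
  have hnorm : ∀ s ∈ Metric.ball s₀ δ, ∀ ω : ℝ, 0 < ω →
      ‖((ω ^ (-α) : ℝ) : ℂ) / (s + ω)‖ ≤ C * (ω ^ (-α) / (1 + ω)) := by
    intro s hs ω hω
    obtain ⟨h1, h2⟩ := hbound s hs ω hω
    have hpow : 0 ≤ ω ^ (-α) := Real.rpow_nonneg hω.le _
    rw [norm_div, Complex.norm_real, Real.norm_of_nonneg hpow, ← mul_div_assoc,
      div_le_div_iff₀ (hδ.trans_le h1) (by positivity)]
    nlinarith
  refine (hasDerivAt_integral_of_dominated_loc_of_deriv_le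
    (F' := fun s ω => -((ω ^ (-α) : ℝ) : ℂ) / (s + ω) ^ 2)
    (bound := fun ω => C * (ω ^ (-α) / (1 + ω)) / δ)
    (Metric.ball_mem_nhds s₀ hδ) (.of_forall fun s => (hmeas s).aestronglyMeasurable)
    ?_ ?_ ?_ ((hint.const_mul C).div_const δ) ?_).2.differentiableAt.differentiableWithinAt
  · refine (hint.const_mul C).mono' (hmeas s₀).aestronglyMeasurable ?_
    filter_upwards [ae_restrict_mem measurableSet_Ioi] with ω hω
    exact hnorm s₀ (Metric.mem_ball_self hδ) ω hω
  · exact (by fun_prop : Measurable fun ω : ℝ =>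
      -((ω ^ (-α) : ℝ) : ℂ) / (s₀ + ω) ^ 2).aestronglyMeasurable
  · filter_upwards [ae_restrict_mem measurableSet_Ioi] with ω hω s hs
    have hω : 0 < ω := hω
    rw [neg_div, norm_neg, sq, ← div_div, norm_div]
    have := (hbound s hs ω hω).1
    gcongr
    exact hnorm s hs ω hω
  · filter_upwards [ae_restrict_mem measurableSet_Ioi] with ω hω s hs
    have hne : s + ω ≠ 0 := norm_pos_iff.1 (hδ.trans_le (hbound s hs ω hω).1)
    have h := (hasDerivAt_const s ((ω ^ (-α) : ℝ) : ℂ)).div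
      ((hasDerivAt_id s).add_const (ω : ℂ)) hne
    simp only [id_eq, zero_mul, mul_one, zero_sub] at h
    exact h

/-- The Stieltjes transform of `ω ^ (-α)` on the slit plane. -/
lemma integral_rpow_neg_div_add_of_mem_slitPlane {α : ℝ} (hα0 : 0 < α) (hα1 : α < 1) {s : ℂ}
    (hs : s ∈ Complex.slitPlane) :
    ∫ ω in Ioi (0 : ℝ), ((ω ^ (-α) : ℝ) : ℂ) / (s + ω) =
      ((Real.pi / Real.sin (Real.pi * α) : ℝ) : ℂ) * s ^ (-α : ℂ) := by
  have hright : DifferentiableOn ℂ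
      (fun s : ℂ => ((Real.pi / Real.sin (Real.pi * α) : ℝ) : ℂ) * s ^ (-α : ℂ))
      Complex.slitPlane := fun z hz =>
    ((differentiableAt_id.cpow_const hz).const_mul _).differentiableWithinAt
  have hpre : IsPreconnected Complex.slitPlane :=
    (Complex.starConvex_one_slitPlane.isPathConnected
      Complex.one_mem_slitPlane).isConnected.isPreconnected
  refine ((differentiableOn_integral_rpow_neg_div_add hα0 hα1).analyticOnNhd
    Complex.isOpen_slitPlane).eqOn_of_preconnected_of_frequently_eq
    (hright.analyticOnNhd Complex.isOpen_slitPlane) hpre Complex.one_mem_slitPlane ?_ hs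
  have htend : Tendsto (fun x : ℝ => (x : ℂ)) (𝓝[>] 1) (𝓝[≠] 1) := by
    refine tendsto_nhdsWithin_iff.2 ⟨?_, ?_⟩
    · exact (Complex.continuous_ofReal.tendsto' 1 1 (by simp)).mono_left nhdsWithin_le_nhds
    · filter_upwards [self_mem_nhdsWithin] with x hx
      simpa using (ne_of_gt hx : x ≠ 1)
  refine htend.frequently (Eventually.frequently ?_)
  filter_upwards [self_mem_nhdsWithin] with x hx
  have hx : 0 < x := one_pos.trans hx
  have h := congrArg (fun y : ℝ => (y : ℂ)) (integral_rpow_neg_div_add_Ioi hα0 hα1 hx)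
  simp only [← integral_complex_ofReal] at h
  push_cast [Complex.ofReal_cpow hx.le] at h ⊢
  exact h


/-- For `0 < α < 1` and `s ∈ ℂ \ (-∞, 0]`,
`1/s^α = ∫_0^∞ μ_α(ω)/(s+ω) dω` where `μ_α(ω) = sin(απ)/(π ω^α)` and `s^α` is the
principal complex power. -/
theorem frequency_distributed_identity
    (α : ℝ) (hα0 : 0 < α) (hα1 : α < 1) (s : ℂ)
    (hs : ∀ x : ℝ, x ≤ 0 → s ≠ (x : ℂ)) :
    1 / s ^ (α : ℂ) =
      ∫ ω in Set.Ioi (0 : ℝ),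
        ((Real.sin (α * Real.pi) / (Real.pi * ω ^ α) : ℝ) : ℂ) / (s + (ω : ℂ)) := by
  have hmem : s ∈ Complex.slitPlane := by
    by_contra hcon
    rw [Complex.mem_slitPlane_iff_not_le_zero, not_not] at hcon
    obtain ⟨hre, him⟩ := Complex.le_def.1 hcon
    exact hs s.re hre (Complex.ext rfl him)
  have hsin := (sin_pi_mul_pos hα0 hα1).ne'
  have hpi := Real.pi_ne_zero
  have hcongr : ∀ ω ∈ Ioi (0 : ℝ),
      ((Real.sin (α * Real.pi) / (Real.pi * ω ^ α) : ℝ) : ℂ) / (s + (ω : ℂ)) =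
        ((Real.sin (Real.pi * α) / Real.pi : ℝ) : ℂ) * (((ω ^ (-α) : ℝ) : ℂ) / (s + ω)) := by
    intro ω hω
    rw [← mul_div_assoc, ← Complex.ofReal_mul, Real.rpow_neg (le_of_lt hω), mul_comm α,
      ← div_eq_mul_inv, div_div]
  rw [setIntegral_congr_fun measurableSet_Ioi hcongr, integral_const_mul,
    integral_rpow_neg_div_add_of_mem_slitPlane hα0 hα1 hmem, ← mul_assoc, ← Complex.ofReal_mul,
    div_mul_div_cancel₀ hpi, div_self hsin, Complex.ofReal_one, one_mul, Complex.cpow_neg, one_div]
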